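/- Let μ_a be a minimizer of I over M_a, and let ν ∈ M_a be compactly supported with finite logarithmic energy E[ν]. Then ∫ (2U^{μ_a}(x) + |x|²) d(ν − μ_a)(x) ≥ 0. -/

import Mathlib

open MeasureTheory Real
open scoped ENNReal

abbrev Plane : Type := EuclideanSpace ℝ (Fin 2)

noncomputable def logKernel (x y : Plane) : ℝ := Real.log (1 / dist x y)

/- For a probability measure `μ`, `wEnergy μ` equals `I[μ] + 1` where
`I[μ] = ∫∫ log(1/|x-y|) dμdμ + ∫ |x|² dμ ∈ (-∞, +∞]`
(the kernel takes the value `+∞` on the diagonal). -/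
open Classical in
noncomputable def wKernel (x y : Plane) : ℝ≥0∞ :=
  if x = y then ⊤ else ENNReal.ofReal (logKernel x y + (‖x‖ ^ 2 + ‖y‖ ^ 2) / 2 + 1)

noncomputable def wEnergy (μ : Measure Plane) : ℝ≥0∞ :=
  ∫⁻ p : Plane × Plane, wKernel p.1 p.2 ∂(μ.prod μ)

def Ma (Γ : Set Plane) (a : ℝ) : Set (Measure Plane) :=
  {μ | IsProbabilityMeasure μ ∧ ENNReal.ofReal a ≤ μ Γ}

def IsMinimizer (Γ : Set Plane) (a : ℝ) (μa : Measure Plane) : Prop :=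
  μa ∈ Ma Γ a ∧ wEnergy μa < ⊤ ∧ ∀ μ ∈ Ma Γ a, wEnergy μa ≤ wEnergy μ

structure RegularCurve (γ : ℝ → Plane) (Γ : Set Plane) : Prop where
  injective : Function.Injective γ
  image : Γ = Set.range γ
  closed : IsClosed Γ
  contDiff : ContDiff ℝ 1 γ
  unitSpeed : ∀ t, ‖deriv γ t‖ = 1
  holder : ∃ α : ℝ, α ∈ Set.Ioc (0:ℝ) 1 ∧ ∃ M : ℝ, 0 ≤ M ∧
    ∀ s t : ℝ, ‖deriv γ t - deriv γ s‖ ≤ M * |t - s| ^ α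

/-- The logarithmic potential `U^μ(x) = ∫ log(1/|x-y|) dμ(y)`. -/
noncomputable def logPot (μ : Measure Plane) (x : Plane) : ℝ := ∫ y, logKernel x y ∂μ

/-- The weighted logarithmic potential, with values in `[0, ∞]`. -/
noncomputable def wPot (μ : Measure Plane) (x : Plane) : ℝ≥0∞ := ∫⁻ y, wKernel x y ∂μ

lemma logKernel_eq (x y : Plane) : logKernel x y = -Real.log (dist x y) := by
  simp [logKernel, Real.log_inv]

lemma logKernel_comm (x y : Plane) : logKernel x y = logKernel y x := by
  simp [logKernel, dist_comm]

lemma wKernel_comm (x y : Plane) : wKernel x y = wKernel y x := by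
  simp only [wKernel, logKernel_comm x y, eq_comm (a := x), add_comm (‖x‖ ^ 2)]

lemma wKernel_self (x : Plane) : wKernel x x = ⊤ := by simp [wKernel]

lemma wKernel_of_ne {x y : Plane} (h : x ≠ y) :
    wKernel x y = ENNReal.ofReal (logKernel x y + (‖x‖ ^ 2 + ‖y‖ ^ 2) / 2 + 1) := by
  simp [wKernel, h]

lemma measurable_logKernel : Measurable (fun p : Plane × Plane => logKernel p.1 p.2) := by
  unfold logKernel
  fun_prop

lemma measurable_wKernel : Measurable (fun p : Plane × Plane => wKernel p.1 p.2) := by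
  unfold wKernel
  refine Measurable.ite (measurableSet_eq_fun measurable_fst measurable_snd) measurable_const ?_
  have := measurable_logKernel
  fun_prop

lemma measurable_wPot (μ : Measure Plane) [SFinite μ] : Measurable (wPot μ) :=
  measurable_wKernel.lintegral_prod_right'

/-- The regularised kernel dominates a quarter of the squared norms. -/
lemma quarter_le_kernel (x y : Plane) :
    (‖x‖ ^ 2 + ‖y‖ ^ 2) / 4 ≤ logKernel x y + (‖x‖ ^ 2 + ‖y‖ ^ 2) / 2 + 1 := by
  rcases eq_or_ne x y with rfl | h
  · simp only [logKernel_eq, dist_self, Real.log_zero]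
    nlinarith [sq_nonneg ‖x‖]
  · have hd : 0 < dist x y := dist_pos.2 h
    have h1 : dist x y ^ 2 ≤ 2 * ‖x‖ ^ 2 + 2 * ‖y‖ ^ 2 := by
      have : dist x y ≤ ‖x‖ + ‖y‖ := by rw [dist_eq_norm]; exact norm_sub_le x y
      nlinarith [sq_nonneg (‖x‖ - ‖y‖)]
    have h2 : Real.log (dist x y) ≤ dist x y ^ 2 / 8 + 1 := by
      have h3 := Real.log_le_sub_one_of_pos (x := dist x y / 2) (by positivity)
      rw [Real.log_div hd.ne' two_ne_zero] at h3
      have h4 : Real.log 2 ≤ 1 := by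
        linarith [Real.log_le_sub_one_of_pos (x := 2) two_pos]
      nlinarith [sq_nonneg (dist x y - 2)]
    rw [logKernel_eq]
    linarith

lemma measure_singleton_of_wPot_ne_top {μ : Measure Plane} {x : Plane} (h : wPot μ x ≠ ⊤) :
    μ {x} = 0 := by
  by_contra h0
  refine h (top_le_iff.1 ?_)
  calc ⊤ = ∫⁻ y in {x}, wKernel x y ∂μ := by
        rw [lintegral_singleton, wKernel_self, ENNReal.top_mul h0]
    _ ≤ wPot μ x := setLIntegral_le_lintegral _ _

lemma ae_ne_of_wPot_ne_top {μ : Measure Plane} {x : Plane} (h : wPot μ x ≠ ⊤) :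
    ∀ᵐ y ∂μ, y ≠ x := by
  rw [ae_iff]
  simpa using measure_singleton_of_wPot_ne_top h

lemma continuousAt_wKernel {x y : Plane} (h : x ≠ y) :
    ContinuousAt (fun z => wKernel z y) x := by
  have h1 : (fun z => ENNReal.ofReal (logKernel z y + (‖z‖ ^ 2 + ‖y‖ ^ 2) / 2 + 1))
      =ᶠ[nhds x] fun z => wKernel z y := by
    filter_upwards [isOpen_ne.mem_nhds h] with z hz using (wKernel_of_ne hz).symm
  refine ContinuousAt.congr ?_ h1
  refine ENNReal.continuous_ofReal.continuousAt.comp ?_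
  have h2 : ContinuousAt (fun z => logKernel z y) x := by
    simp only [logKernel_eq]
    exact ((continuous_id.dist continuous_const).continuousAt.log (dist_pos.2 h).ne').neg
  have h3 : Continuous fun z : Plane => (‖z‖ ^ 2 + ‖y‖ ^ 2) / 2 := by fun_prop
  exact (h2.add h3.continuousAt).add continuousAt_const

/-- Change of the base point in the kernel, when the distances are comparable. -/
lemma wKernel_le_add {x z y : Plane} {b c : ℝ} (hx : x ≠ y)
    (hlog : logKernel x y ≤ logKernel z y + b) (hnorm : ‖x‖ ^ 2 / 2 ≤ ‖z‖ ^ 2 / 2 + c) :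
    wKernel x y ≤ wKernel z y + ENNReal.ofReal (b + c) := by
  rcases eq_or_ne z y with rfl | hz
  · simp [wKernel_self]
  · rw [wKernel_of_ne hx, wKernel_of_ne hz]
    refine le_trans (ENNReal.ofReal_le_ofReal ?_) ENNReal.ofReal_add_le
    linarith

/-- A weak maximum principle: an almost everywhere bound on the weighted potential extends to
a bound at every point. -/
lemma wPot_le_of_ae_le {μ : Measure Plane} [IsProbabilityMeasure μ] {M : ℝ≥0∞} (hM : M ≠ ⊤)
    (hatom : ∀ x, μ {x} = 0) (h : ∀ᵐ x ∂μ, wPot μ x ≤ M) (x : Plane) :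
    wPot μ x ≤ M + ENNReal.ofReal (Real.log 3 + ‖x‖ ^ 2 / 2) := by
  set S : Set Plane := {z | wPot μ z ≤ M} with hS
  have hne : S.Nonempty := h.exists
  by_cases hx : x ∈ closure S
  · obtain ⟨u, hu, hlim⟩ := mem_closure_iff_seq_limit.1 hx
    refine le_trans ?_ le_self_add
    have hae : ∀ᵐ y ∂μ, x ≠ y := by
      rw [ae_iff]; simpa [eq_comm] using hatom x
    calc wPot μ x = ∫⁻ y, Filter.liminf (fun n => wKernel (u n) y) Filter.atTop ∂μ := by
          refine lintegral_congr_ae ?_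
          filter_upwards [hae] with y hy
          exact (((continuousAt_wKernel hy).tendsto.comp hlim).liminf_eq).symm
      _ ≤ Filter.liminf (fun n => wPot μ (u n)) Filter.atTop :=
          lintegral_liminf_le fun n => measurable_wKernel.comp measurable_prodMk_left
      _ ≤ M := by
          refine Filter.liminf_le_of_frequently_le' ?_
          exact Filter.Frequently.of_forall hu
  · have hr : 0 < Metric.infDist x S := by
      rw [Metric.mem_closure_iff_infDist_zero hne] at hx
      exact lt_of_le_of_ne Metric.infDist_nonneg (Ne.symm hx)
    obtain ⟨z, hz, hxz⟩ := (Metric.infDist_lt_iff hne).1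
      (show Metric.infDist x S < 2 * Metric.infDist x S by linarith)
    have hz' : wPot μ z ≤ M := hz
    have hae := ae_ne_of_wPot_ne_top (ne_top_of_le_ne_top hM hz')
    calc wPot μ x ≤ ∫⁻ y, (wKernel z y + ENNReal.ofReal (Real.log 3 + ‖x‖ ^ 2 / 2)) ∂μ := by
          refine lintegral_mono_ae ?_
          filter_upwards [h, hae] with y hy hyz
          have hxy : Metric.infDist x S ≤ dist x y := Metric.infDist_le_dist_of_mem hy
          have hpos : 0 < dist x y := by linarith
          have hzy : 0 < dist z y := dist_pos.2 hyz.symm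
          refine wKernel_le_add (dist_pos.1 hpos) ?_ (by nlinarith [sq_nonneg ‖z‖])
          have h3 : dist z y ≤ 3 * dist x y := by
            linarith [dist_triangle_left z y x]
          have := Real.log_le_log hzy h3
          rw [Real.log_mul three_ne_zero hpos.ne'] at this
          rw [logKernel_eq, logKernel_eq]
          linarith
      _ = wPot μ z + ENNReal.ofReal (Real.log 3 + ‖x‖ ^ 2 / 2) := by
          rw [lintegral_add_right _ measurable_const]
          simp [wPot]
      _ ≤ _ := by gcongr

/-- Where the weighted potential is finite, it determines the logarithmic potential. -/
lemma integrable_and_logPot_eq {μ : Measure Plane} [IsProbabilityMeasure μ] {x : Plane}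
    (h : wPot μ x ≠ ⊤) : Integrable (fun y : Plane => ‖y‖ ^ 2) μ ∧
      2 * logPot μ x + ‖x‖ ^ 2 = 2 * (wPot μ x).toReal - ((∫ y : Plane, ‖y‖ ^ 2 ∂μ) + 2) := by
  obtain ⟨g, hg⟩ : ∃ g : Plane → ℝ, ∀ y, g y = logKernel x y + (‖x‖ ^ 2 + ‖y‖ ^ 2) / 2 + 1 :=
    ⟨_, fun _ => rfl⟩
  have hg4 : ∀ y, (‖x‖ ^ 2 + ‖y‖ ^ 2) / 4 ≤ g y := fun y =>
    (quarter_le_kernel x y).trans_eq (hg y).symm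
  have hg0 : ∀ y, 0 ≤ g y := fun y => le_trans (by positivity) (hg4 y)
  have hml : Measurable fun y => logKernel x y := by
    unfold logKernel
    fun_prop
  have hgm : Measurable g := by
    rw [funext hg]
    fun_prop
  have heq : wPot μ x = ∫⁻ y, ENNReal.ofReal (g y) ∂μ := by
    refine lintegral_congr_ae ?_
    filter_upwards [ae_ne_of_wPot_ne_top h] with y hy
    rw [wKernel_of_ne hy.symm, hg]
  have hgi : Integrable g μ := by
    rw [← lintegral_ofReal_ne_top_iff_integrable hgm.aestronglyMeasurable
      (Filter.Eventually.of_forall hg0), ← heq]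
    exact h
  have hni : Integrable (fun y : Plane => ‖y‖ ^ 2) μ := by
    refine (hgi.const_mul 4).mono' (by fun_prop) (Filter.Eventually.of_forall fun y => ?_)
    rw [Real.norm_of_nonneg (by positivity)]
    nlinarith [hg4 y, sq_nonneg ‖x‖]
  refine ⟨hni, ?_⟩
  have hV : (wPot μ x).toReal = ∫ y, g y ∂μ := by
    rw [heq, integral_eq_lintegral_of_nonneg_ae (Filter.Eventually.of_forall hg0)
      hgm.aestronglyMeasurable]
  have hk : ∀ y, logKernel x y = g y - (‖y‖ ^ 2 / 2 + (‖x‖ ^ 2 / 2 + 1)) := by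
    intro y; rw [hg]; ring
  have hU : logPot μ x = (∫ y, g y ∂μ) - ((∫ y : Plane, ‖y‖ ^ 2 ∂μ) / 2 + (‖x‖ ^ 2 / 2 + 1)) := by
    unfold logPot
    simp_rw [hk]
    have hi : Integrable (fun y : Plane => ‖y‖ ^ 2 / 2 + (‖x‖ ^ 2 / 2 + 1)) μ :=
      (hni.div_const 2).add (integrable_const _)
    rw [integral_sub hgi hi,
      integral_add (hni.div_const 2) (integrable_const _), integral_div]
    simp
  rw [hU, hV]
  ring

/-- A probability measure carried by a bounded set whose weighted potential is bounded on
bounded sets. -/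
structure IsTame (σ : Measure Plane) : Prop where
  prob : IsProbabilityMeasure σ
  bounded : ∃ R : ℝ, ∀ᵐ z ∂σ, ‖z‖ ≤ R
  wPot_bounded : ∀ R : ℝ, ∃ C : ℝ≥0∞, C ≠ ⊤ ∧ ∀ y, ‖y‖ ≤ R → wPot σ y ≤ C

lemma lintegral_wPot_comm (μ ν : Measure Plane) [SFinite μ] [SFinite ν] :
    ∫⁻ x, wPot μ x ∂ν = ∫⁻ x, wPot ν x ∂μ := by
  unfold wPot
  rw [lintegral_lintegral_swap measurable_wKernel.aemeasurable]
  simp_rw [wKernel_comm]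

lemma wEnergy_eq (μ : Measure Plane) [SFinite μ] : wEnergy μ = ∫⁻ x, wPot μ x ∂μ :=
  lintegral_prod _ measurable_wKernel.aemeasurable

lemma wPot_combo (μ ν : Measure Plane) (s t : ℝ≥0∞) (x : Plane) :
    wPot (s • μ + t • ν) x = s * wPot μ x + t * wPot ν x := by
  simp [wPot, lintegral_add_measure, lintegral_smul_measure]

lemma isProbabilityMeasure_combo {μ ν : Measure Plane} [IsProbabilityMeasure μ]
    [IsProbabilityMeasure ν] {t : ℝ} (h0 : 0 ≤ t) (h1 : t ≤ 1) :
    IsProbabilityMeasure (ENNReal.ofReal t • μ + ENNReal.ofReal (1 - t) • ν) := by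
  refine ⟨?_⟩
  simp [← ENNReal.ofReal_add h0 (sub_nonneg.2 h1)]

lemma IsTame.combo {μ ν : Measure Plane} (hμ : IsTame μ) (hν : IsTame ν) {t : ℝ}
    (h0 : 0 ≤ t) (h1 : t ≤ 1) :
    IsTame (ENNReal.ofReal t • μ + ENNReal.ofReal (1 - t) • ν) := by
  have := hμ.prob
  have := hν.prob
  refine ⟨isProbabilityMeasure_combo h0 h1, ?_, fun R => ?_⟩
  · obtain ⟨R, hR⟩ := hμ.bounded
    obtain ⟨R', hR'⟩ := hν.bounded
    refine ⟨max R R', ?_⟩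
    rw [ae_add_measure_iff]
    exact ⟨Measure.ae_smul_measure (hR.mono fun z hz => hz.trans (le_max_left _ _)) _,
      Measure.ae_smul_measure (hR'.mono fun z hz => hz.trans (le_max_right _ _)) _⟩
  · obtain ⟨C, hC, h⟩ := hμ.wPot_bounded R
    obtain ⟨C', hC', h'⟩ := hν.wPot_bounded R
    refine ⟨ENNReal.ofReal t * C + ENNReal.ofReal (1 - t) * C', by finiteness, fun y hy => ?_⟩
    rw [wPot_combo]
    gcongr
    · exact h y hy
    · exact h' y hy

lemma IsTame.wEnergy_ne_top {σ : Measure Plane} (hσ : IsTame σ) : wEnergy σ ≠ ⊤ := by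
  have := hσ.prob
  obtain ⟨R, hR⟩ := hσ.bounded
  obtain ⟨C, hC, h⟩ := hσ.wPot_bounded R
  rw [wEnergy_eq]
  refine ne_top_of_le_ne_top hC ?_
  calc ∫⁻ x, wPot σ x ∂σ ≤ ∫⁻ _, C ∂σ := lintegral_mono_ae (hR.mono fun y hy => h y hy)
    _ = C := by simp

lemma wEnergy_combo (μ ν : Measure Plane) [IsFiniteMeasure μ] [IsFiniteMeasure ν] (s t : ℝ≥0∞)
    (hs : s ≠ ⊤) (ht : t ≠ ⊤) :
    wEnergy (s • μ + t • ν) =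
      s * (s * wEnergy μ + t * ∫⁻ x, wPot μ x ∂ν) + t * (s * (∫⁻ x, wPot μ x ∂ν) + t * wEnergy ν) := by
  have := Measure.smul_finite μ hs
  have := Measure.smul_finite ν ht
  have hμ := measurable_wPot μ
  have hν := measurable_wPot ν
  rw [wEnergy_eq, wEnergy_eq, wEnergy_eq]
  simp_rw [wPot_combo]
  rw [lintegral_add_measure, lintegral_smul_measure, lintegral_smul_measure,
    lintegral_add_left (hμ.const_mul s), lintegral_add_left (hμ.const_mul s),
    lintegral_const_mul _ hμ, lintegral_const_mul _ hν, lintegral_const_mul _ hμ,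
    lintegral_const_mul _ hν, lintegral_wPot_comm ν μ]
  simp

/-- First variation: the minimizer's potential tested against competitors of finite energy. -/
lemma IsMinimizer.wEnergy_le_lintegral {Γ : Set Plane} {a : ℝ} {μ σ : Measure Plane}
    (hmin : IsMinimizer Γ a μ) (hσ : σ ∈ Ma Γ a) (hE : wEnergy σ ≠ ⊤) :
    wEnergy μ ≤ ∫⁻ x, wPot μ x ∂σ := by
  obtain ⟨⟨hpμ, hμΓ⟩, hJ, hle⟩ := hmin
  obtain ⟨hpσ, hσΓ⟩ := hσ
  by_contra! hlt
  have hX : ∫⁻ x, wPot μ x ∂σ ≠ ⊤ := (hlt.trans hJ).ne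
  set J := (wEnergy μ).toReal with hJdef
  set X := (∫⁻ x, wPot μ x ∂σ).toReal with hXdef
  set E := (wEnergy σ).toReal with hEdef
  have hXJ : X < J := (ENNReal.toReal_lt_toReal hX hJ.ne).2 hlt
  have hE0 : 0 ≤ E := ENNReal.toReal_nonneg
  have hX0 : 0 ≤ X := ENNReal.toReal_nonneg
  have key : ∀ t : ℝ, 0 ≤ t → t ≤ 1 →
      J ≤ (1 - t) * ((1 - t) * J + t * X) + t * ((1 - t) * X + t * E) := by
    intro t h0 h1
    have h1' : 0 ≤ 1 - t := sub_nonneg.2 h1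
    have hmem : ENNReal.ofReal (1 - t) • μ + ENNReal.ofReal t • σ ∈ Ma Γ a := by
      refine ⟨?_, ?_⟩
      · simpa using isProbabilityMeasure_combo (μ := μ) (ν := σ) h1' (by linarith)
      · calc ENNReal.ofReal a
            = ENNReal.ofReal (1 - t) * ENNReal.ofReal a + ENNReal.ofReal t * ENNReal.ofReal a := by
              rw [← add_mul, ← ENNReal.ofReal_add h1' h0]; simp
          _ ≤ ENNReal.ofReal (1 - t) * μ Γ + ENNReal.ofReal t * σ Γ := by gcongr
          _ = _ := by simp
    have h := hle _ hmem
    rw [wEnergy_combo _ _ _ _ ENNReal.ofReal_ne_top ENNReal.ofReal_ne_top,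
      ← ENNReal.ofReal_toReal hJ.ne, ← ENNReal.ofReal_toReal hX, ← ENNReal.ofReal_toReal hE,
      ← hJdef, ← hXdef, ← hEdef] at h
    have hJ0 : 0 ≤ J := ENNReal.toReal_nonneg
    simp only [← ENNReal.ofReal_mul h0, ← ENNReal.ofReal_mul h1'] at h
    rw [← ENNReal.ofReal_add (by positivity) (by positivity),
      ← ENNReal.ofReal_add (by positivity) (by positivity), ← ENNReal.ofReal_mul h1',
      ← ENNReal.ofReal_mul h0, ← ENNReal.ofReal_add (by positivity) (by positivity)] at h
    exact (ENNReal.ofReal_le_ofReal_iff (by positivity)).1 h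
  have hD : 0 < J - X + E := by linarith
  have hs1 : (J - X) / (J - X + E) ≤ 1 := (div_le_one hD).2 (by linarith)
  have hs0 : 0 < (J - X) / (J - X + E) := div_pos (by linarith) hD
  have hs := key _ hs0.le hs1
  set s := (J - X) / (J - X + E) with hsdef
  have hsD : s * (J - X + E) = J - X := div_mul_cancel₀ _ hD.ne'
  nlinarith [mul_pos hs0 (sub_pos.2 hXJ), mul_nonneg (mul_nonneg hs0.le hs0.le) hX0,
    congrArg (fun r => s * r) hsD, mul_pos (mul_pos hs0 hs0) (sub_pos.2 hXJ)]

lemma lintegral_neg_log_lt_top :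
    ∫⁻ w in Set.Icc (-1 : ℝ) 1, ENNReal.ofReal (Real.log 9 - Real.log w) < ⊤ := by
  have h : IntegrableOn (fun w : ℝ => Real.log 9 - Real.log w) (Set.Icc (-1) 1) := by
    rw [← intervalIntegrable_iff_integrableOn_Icc_of_le (by norm_num)]
    exact intervalIntegrable_const.sub intervalIntegral.intervalIntegrable_log'
  exact h.lintegral_lt_top

lemma lintegral_log_shift_le {v₀ : ℝ} (h : v₀ ∈ Set.Icc (0 : ℝ) 1) :
    ∫⁻ v in Set.Icc (0 : ℝ) 1, ENNReal.ofReal (Real.log 9 - Real.log (v - v₀)) ≤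
      ∫⁻ w in Set.Icc (-1 : ℝ) 1, ENNReal.ofReal (Real.log 9 - Real.log w) := by
  rw [← lintegral_indicator measurableSet_Icc, ← lintegral_indicator measurableSet_Icc,
    ← lintegral_sub_right_eq_self ((Set.Icc (-1 : ℝ) 1).indicator _) v₀]
  refine lintegral_mono fun v => ?_
  by_cases hv : v ∈ Set.Icc (0 : ℝ) 1
  · rw [Set.indicator_of_mem hv, Set.indicator_of_mem]
    exact ⟨by linarith [hv.1, h.2], by linarith [hv.2, h.1]⟩
  · rw [Set.indicator_of_notMem hv]
    exact zero_le

/-- The image of the uniform distribution on `[0, ε]` under a curve. -/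
noncomputable def curveMeasure (β : ℝ → Plane) (ε : ℝ) : Measure Plane :=
  (volume.restrict (Set.Icc (0 : ℝ) 1)).map fun v => β (ε * v)

/-- Bi-Lipschitz bounds on an initial segment of a curve. -/
def IsNearlyStraight (β : ℝ → Plane) (δ : ℝ) : Prop :=
  ∀ s ∈ Set.Icc 0 δ, ∀ t ∈ Set.Icc 0 δ,
    |s - t| / 2 ≤ dist (β s) (β t) ∧ dist (β s) (β t) ≤ 2 * |s - t|

instance isProbabilityMeasure_unitInterval :
    IsProbabilityMeasure (volume.restrict (Set.Icc (0 : ℝ) 1)) := ⟨by simp⟩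

lemma isProbabilityMeasure_curveMeasure {β : ℝ → Plane} (hβ : Continuous β) (ε : ℝ) :
    IsProbabilityMeasure (curveMeasure β ε) :=
  Measure.isProbabilityMeasure_map (by fun_prop)

lemma wPot_curveMeasure {β : ℝ → Plane} (hβ : Continuous β) (ε : ℝ) (y : Plane) :
    wPot (curveMeasure β ε) y = ∫⁻ v in Set.Icc (0 : ℝ) 1, wKernel (β (ε * v)) y := by
  unfold wPot curveMeasure
  have hm : Measurable fun z => wKernel y z := measurable_wKernel.comp measurable_prodMk_left
  rw [lintegral_map hm (by fun_prop)]
  simp_rw [wKernel_comm y]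

lemma IsNearlyStraight.exists_dist_ge {β : ℝ → Plane} {δ ε : ℝ} (h : IsNearlyStraight β δ)
    (hβ : Continuous β) (hε : 0 < ε) (hεδ : ε ≤ δ) (y : Plane) :
    ∃ v₀ ∈ Set.Icc (0 : ℝ) 1, ∀ v ∈ Set.Icc (0 : ℝ) 1,
      ε * |v - v₀| / 4 ≤ dist (β (ε * v)) y := by
  obtain ⟨v₀, hv₀, hmin⟩ := (isCompact_Icc (a := (0 : ℝ)) (b := 1)).exists_isMinOn
    (Set.nonempty_Icc.2 zero_le_one)
    (f := fun v => dist (β (ε * v)) y) (by fun_prop)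
  refine ⟨v₀, hv₀, fun v hv => ?_⟩
  have hmem : ∀ w ∈ Set.Icc (0 : ℝ) 1, ε * w ∈ Set.Icc 0 δ := fun w hw =>
    ⟨by have := hw.1; positivity, by nlinarith [hw.2]⟩
  have h1 := (h _ (hmem v hv) _ (hmem v₀ hv₀)).1
  rw [← mul_sub, abs_mul, abs_of_pos hε] at h1
  have h2 : dist (β (ε * v₀)) y ≤ dist (β (ε * v)) y := hmin hv
  linarith [dist_triangle_right (β (ε * v)) (β (ε * v₀)) y]

lemma IsNearlyStraight.norm_le {β : ℝ → Plane} {δ ε v : ℝ} (h : IsNearlyStraight β δ)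
    (hε : 0 < ε) (hεδ : ε ≤ δ) (hv : v ∈ Set.Icc (0 : ℝ) 1) :
    dist (β (ε * v)) (β 0) ≤ 2 * ε := by
  have := (h (ε * v) ⟨by have := hv.1; positivity, by nlinarith [hv.2]⟩ 0
    ⟨le_rfl, by linarith⟩).2
  rw [sub_zero, abs_of_nonneg (by have := hv.1; positivity)] at this
  nlinarith [hv.2]

lemma norm_sq_le_of_dist_le {x p : Plane} {r : ℝ} (h : dist x p ≤ r) :
    ‖x‖ ^ 2 ≤ (‖p‖ + r) ^ 2 := by
  have : ‖x‖ ≤ ‖p‖ + r := by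
    have := norm_le_norm_add_norm_sub' x p
    rw [dist_eq_norm] at h
    linarith
  gcongr

lemma ae_unitInterval_ne (v₀ : ℝ) :
    ∀ᵐ v ∂(volume.restrict (Set.Icc (0 : ℝ) 1)), v ∈ Set.Icc (0 : ℝ) 1 ∧ v ≠ v₀ := by
  refine (ae_restrict_mem measurableSet_Icc).and (ae_restrict_of_ae ?_)
  rw [ae_iff]
  simp

/-- Smearing a point mass along a curve increases the kernel by a bounded amount, uniformly in
the smearing scale. -/
lemma IsNearlyStraight.wPot_le {β : ℝ → Plane} {δ ε : ℝ} (h : IsNearlyStraight β δ)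
    (hβ : Continuous β) (hε : 0 < ε) (hεδ : ε ≤ δ) (hε1 : ε ≤ 1) (y : Plane) :
    wPot (curveMeasure β ε) y ≤ wKernel (β 0) y +
      ((∫⁻ w in Set.Icc (-1 : ℝ) 1, ENNReal.ofReal (Real.log 9 - Real.log w)) +
        ENNReal.ofReal ((‖β 0‖ + 2) ^ 2 / 2)) := by
  obtain ⟨v₀, hv₀, hge⟩ := h.exists_dist_ge hβ hε hεδ y
  rw [wPot_curveMeasure hβ]
  rcases eq_or_ne (β 0) y with hy | hy
  · simp [hy, wKernel_self]
  calc ∫⁻ v in Set.Icc (0 : ℝ) 1, wKernel (β (ε * v)) y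
      ≤ ∫⁻ v in Set.Icc (0 : ℝ) 1, (wKernel (β 0) y +
          (ENNReal.ofReal (Real.log 9 - Real.log (v - v₀)) +
            ENNReal.ofReal ((‖β 0‖ + 2) ^ 2 / 2))) := by
        refine lintegral_mono_ae ?_
        filter_upwards [ae_unitInterval_ne v₀] with v ⟨hv, hne⟩
        have hw : 0 < |v - v₀| := abs_pos.2 (sub_ne_zero.2 hne)
        have hw1 : |v - v₀| ≤ 1 :=
          abs_le.2 ⟨by linarith [hv.1, hv₀.2], by linarith [hv.2, hv₀.1]⟩
        have hD := hge v hv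
        have hDpos : 0 < dist (β (ε * v)) y := lt_of_lt_of_le (by positivity) hD
        have hd := h.norm_le hε hεδ hv
        have hpd : 0 < dist (β 0) y := dist_pos.2 hy
        have hratio : dist (β 0) y * |v - v₀| ≤ 9 * dist (β (ε * v)) y := by
          have := dist_triangle_left (β 0) y (β (ε * v))
          nlinarith
        have hlog := Real.log_le_log (by positivity) hratio
        rw [Real.log_mul hpd.ne' hw.ne', Real.log_mul (by norm_num) hDpos.ne',
          Real.log_abs] at hlog
        have hlog9 : 0 ≤ Real.log 9 - Real.log (v - v₀) := by
          have h1 := Real.log_nonpos hw.le hw1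
          rw [Real.log_abs] at h1
          have h2 : 0 ≤ Real.log 9 := Real.log_nonneg (by norm_num)
          linarith
        rw [← ENNReal.ofReal_add hlog9 (by positivity)]
        refine wKernel_le_add (dist_pos.1 hDpos) ?_ ?_
        · rw [logKernel_eq, logKernel_eq]
          linarith
        · have := norm_sq_le_of_dist_le (hd.trans (show 2 * ε ≤ 2 by linarith))
          nlinarith [sq_nonneg ‖β 0‖]
    _ = wKernel (β 0) y + ((∫⁻ v in Set.Icc (0 : ℝ) 1,
          ENNReal.ofReal (Real.log 9 - Real.log (v - v₀))) +
            ENNReal.ofReal ((‖β 0‖ + 2) ^ 2 / 2)) := by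
        rw [lintegral_add_left measurable_const, lintegral_add_right _ measurable_const]
        simp
    _ ≤ _ := by
        exact add_le_add_right (add_le_add_left (lintegral_log_shift_le hv₀) _) _

lemma IsNearlyStraight.isTame {β : ℝ → Plane} {δ ε : ℝ} (h : IsNearlyStraight β δ)
    (hβ : Continuous β) (hε : 0 < ε) (hεδ : ε ≤ δ) : IsTame (curveMeasure β ε) := by
  refine ⟨isProbabilityMeasure_curveMeasure hβ ε, ⟨‖β 0‖ + 2 * ε, ?_⟩, fun R => ?_⟩
  · unfold curveMeasure
    rw [ae_map_iff (by fun_prop) (measurableSet_le measurable_norm measurable_const)]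
    filter_upwards [ae_restrict_mem measurableSet_Icc] with v hv
    have := norm_le_norm_add_norm_sub' (β (ε * v)) (β 0)
    have h2 := h.norm_le hε hεδ hv
    rw [dist_eq_norm] at h2
    linarith
  · set c : ℝ := |Real.log (4 / ε)| + ((‖β 0‖ + 2 * ε) ^ 2 + R ^ 2) / 2 + 1 with hc
    have hc0 : 0 ≤ c := by positivity
    refine ⟨(∫⁻ w in Set.Icc (-1 : ℝ) 1, ENNReal.ofReal (Real.log 9 - Real.log w)) +
      ENNReal.ofReal c, ENNReal.add_ne_top.2 ⟨lintegral_neg_log_lt_top.ne, ENNReal.ofReal_ne_top⟩,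
      fun y hy => ?_⟩
    obtain ⟨v₀, hv₀, hge⟩ := h.exists_dist_ge hβ hε hεδ y
    rw [wPot_curveMeasure hβ]
    calc ∫⁻ v in Set.Icc (0 : ℝ) 1, wKernel (β (ε * v)) y
        ≤ ∫⁻ v in Set.Icc (0 : ℝ) 1, (ENNReal.ofReal (Real.log 9 - Real.log (v - v₀)) +
            ENNReal.ofReal c) := by
          refine lintegral_mono_ae ?_
          filter_upwards [ae_unitInterval_ne v₀] with v ⟨hv, hne⟩
          have hw : 0 < |v - v₀| := abs_pos.2 (sub_ne_zero.2 hne)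
          have hD := hge v hv
          have hDpos : 0 < dist (β (ε * v)) y := lt_of_lt_of_le (by positivity) hD
          have hlog := Real.log_le_log (by positivity) hD
          rw [show ε * |v - v₀| / 4 = |v - v₀| / (4 / ε) by field_simp,
            Real.log_div hw.ne' (by positivity), Real.log_abs] at hlog
          rw [wKernel_of_ne (dist_pos.1 hDpos)]
          refine le_trans (ENNReal.ofReal_le_ofReal ?_) ENNReal.ofReal_add_le
          have h1 := norm_sq_le_of_dist_le (h.norm_le hε hεδ hv)
          have h2 : ‖y‖ ^ 2 ≤ R ^ 2 := by gcongr
          have h3 : 0 ≤ Real.log 9 := Real.log_nonneg (by norm_num)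
          rw [logKernel_eq]
          linarith [le_abs_self (Real.log (4 / ε))]
      _ = (∫⁻ v in Set.Icc (0 : ℝ) 1, ENNReal.ofReal (Real.log 9 - Real.log (v - v₀))) +
            ENNReal.ofReal c := by
          rw [lintegral_add_right _ measurable_const]
          simp
      _ ≤ _ := by
          exact add_le_add_left (lintegral_log_shift_le hv₀) _

/-- Averages of the weighted potential along a curve do not exceed, in the limit, its value at
the starting point. -/
lemma IsNearlyStraight.exists_lintegral_wPot_le {β : ℝ → Plane} {δ : ℝ} (h : IsNearlyStraight β δ)
    (hβ : Continuous β) (hδ : 0 < δ) (μ : Measure Plane) [IsProbabilityMeasure μ]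
    (hfin : wPot μ (β 0) ≠ ⊤) {b : ℝ≥0∞} (hb : wPot μ (β 0) < b) :
    ∃ ε, 0 < ε ∧ ε ≤ δ ∧ ∫⁻ z, wPot μ z ∂(curveMeasure β ε) ≤ b := by
  set e : ℕ → ℝ := fun n => min δ 1 * (1 / ((n : ℝ) + 1)) with he
  have hm : 0 < min δ 1 := lt_min hδ one_pos
  have he0 : ∀ n, 0 < e n := fun n => by positivity
  have hele : ∀ n, e n ≤ min δ 1 := fun n =>
    mul_le_of_le_one_right hm.le (by
      rw [div_le_one (by positivity)]; linarith [Nat.cast_nonneg (α := ℝ) n])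
  have hlim : Filter.Tendsto e Filter.atTop (nhds 0) := by
    simpa [he] using (tendsto_one_div_add_atTop_nhds_zero_nat (𝕜 := ℝ)).const_mul (min δ 1)
  have hprob := fun n => isProbabilityMeasure_curveMeasure hβ (e n)
  set C : ℝ≥0∞ := (∫⁻ w in Set.Icc (-1 : ℝ) 1, ENNReal.ofReal (Real.log 9 - Real.log w)) +
        ENNReal.ofReal ((‖β 0‖ + 2) ^ 2 / 2) with hC
  have hCt : C ≠ ⊤ := ENNReal.add_ne_top.2 ⟨lintegral_neg_log_lt_top.ne, ENNReal.ofReal_ne_top⟩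
  have hsup := limsup_lintegral_le (μ := μ) (f := fun n y => wPot (curveMeasure β (e n)) y)
    (fun y => wKernel (β 0) y + C) (fun n => measurable_wPot _)
    (fun n => Filter.Eventually.of_forall fun y => h.wPot_le hβ (he0 n)
      ((hele n).trans (min_le_left _ _)) ((hele n).trans (min_le_right _ _)) y)
    (by
      rw [lintegral_add_right _ measurable_const]
      simpa using ⟨hfin, hCt⟩)
  have hpt : ∀ y, Filter.limsup (fun n => wPot (curveMeasure β (e n)) y) Filter.atTop ≤
      wKernel (β 0) y := by
    intro y
    rcases eq_or_ne (β 0) y with hy | hy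
    · simp [hy, wKernel_self]
    refine le_of_forall_gt fun c hc => ?_
    obtain ⟨c', hc1, hc2⟩ := exists_between hc
    refine lt_of_le_of_lt (Filter.limsup_le_of_le (h := ?_)) hc2
    have hcont : ContinuousAt (fun u => wKernel (β u) y) 0 :=
      ContinuousAt.comp (f := β) (continuousAt_wKernel hy) hβ.continuousAt
    obtain ⟨r, hr, hball⟩ := Metric.eventually_nhds_iff.1 (hcont.eventually_lt_const hc1)
    filter_upwards [hlim.eventually_lt_const hr] with n hn
    rw [wPot_curveMeasure hβ]
    calc ∫⁻ v in Set.Icc (0 : ℝ) 1, wKernel (β (e n * v)) y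
        ≤ ∫⁻ v in Set.Icc (0 : ℝ) 1, c' := by
          refine setLIntegral_mono measurable_const fun v hv => ?_
          refine (hball ?_).le
          rw [dist_zero_right, Real.norm_of_nonneg (mul_nonneg (he0 n).le hv.1)]
          nlinarith [hv.2, he0 n]
      _ = c' := by simp
  have hlt : Filter.limsup (fun n => ∫⁻ y, wPot (curveMeasure β (e n)) y ∂μ) Filter.atTop < b :=
    lt_of_le_of_lt (hsup.trans (lintegral_mono hpt)) hb
  obtain ⟨n, hn⟩ := (Filter.eventually_lt_of_limsup_lt hlt).exists
  refine ⟨e n, he0 n, (hele n).trans (min_le_left _ _), ?_⟩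
  rw [lintegral_wPot_comm]
  exact hn.le

lemma HasStrictDerivAt.exists_isNearlyStraight {γ : ℝ → Plane} {γ' : Plane} {s₀ : ℝ}
    (h : HasStrictDerivAt γ γ' s₀) (hγ' : ‖γ'‖ = 1) :
    ∃ δ, 0 < δ ∧ IsNearlyStraight (fun u => γ (s₀ + u)) δ := by
  obtain ⟨S, hS, happ⟩ := h.hasStrictFDerivAt.approximates_deriv_on_nhds (c := 1 / 2)
    (Or.inr (by norm_num))
  obtain ⟨r, hr, hball⟩ := Metric.mem_nhds_iff.1 hS
  refine ⟨r / 2, by positivity, fun s hs t ht => ?_⟩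
  have hmem : ∀ u ∈ Set.Icc 0 (r / 2), s₀ + u ∈ S := fun u hu => hball (by
    rw [Metric.mem_ball, dist_eq_norm, add_sub_cancel_left, Real.norm_of_nonneg hu.1]
    linarith [hu.2])
  have h1 := happ _ (hmem s hs) _ (hmem t ht)
  have h2 : ‖(s - t) • γ'‖ = |s - t| := by rw [norm_smul, hγ', mul_one, Real.norm_eq_abs]
  simp only [add_sub_add_left_eq_sub, ContinuousLinearMap.toSpanSingleton_apply,
    Real.norm_eq_abs] at h1
  norm_num at h1
  have h3 := norm_sub_norm_le ((s - t) • γ') (γ (s₀ + s) - γ (s₀ + t))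
  have h4 := norm_sub_norm_le (γ (s₀ + s) - γ (s₀ + t)) ((s - t) • γ')
  rw [norm_sub_rev ((s - t) • γ')] at h3
  rw [dist_eq_norm]
  constructor <;> linarith [abs_nonneg (s - t)]

/-- Every point of a curve with unit-length strict derivative is a limit of tame measures on
the curve. -/
lemma exists_isTame_lintegral_le {γ : ℝ → Plane} {γ' : Plane} {s₀ : ℝ} (hγ : Continuous γ)
    (h : HasStrictDerivAt γ γ' s₀) (hγ' : ‖γ'‖ = 1) (hγm : MeasurableSet (Set.range γ))
    (μ : Measure Plane) [IsProbabilityMeasure μ]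
    (hfin : wPot μ (γ s₀) ≠ ⊤) {b : ℝ≥0∞} (hb : wPot μ (γ s₀) < b) :
    ∃ σ, IsTame σ ∧ σ (Set.range γ) = 1 ∧ ∫⁻ z, wPot μ z ∂σ ≤ b := by
  obtain ⟨δ, hδ, hst⟩ := h.exists_isNearlyStraight hγ'
  have hβ : Continuous fun u => γ (s₀ + u) := by fun_prop
  obtain ⟨ε, hε, hεδ, hle⟩ := hst.exists_lintegral_wPot_le hβ hδ μ (by simpa using hfin)
    (b := b) (by simpa using hb)
  refine ⟨_, hst.isTame hβ hε hεδ, ?_, hle⟩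
  rw [curveMeasure, Measure.map_apply (by fun_prop) hγm]
  have : (fun v => γ (s₀ + ε * v)) ⁻¹' Set.range γ = Set.univ :=
    Set.eq_univ_of_forall fun v => ⟨_, rfl⟩
  rw [this]
  exact measure_univ

lemma exists_isTame_lintegral_le_of_point (q : Plane) (μ : Measure Plane) [IsProbabilityMeasure μ]
    (hfin : wPot μ q ≠ ⊤) {b : ℝ≥0∞} (hb : wPot μ q < b) :
    ∃ σ, IsTame σ ∧ ∫⁻ z, wPot μ z ∂σ ≤ b := by
  obtain ⟨e, he⟩ := exists_norm_eq Plane zero_le_one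
  have hd : HasStrictDerivAt (fun u : ℝ => q + u • e) e 0 := by
    simpa using ((hasStrictDerivAt_id (0 : ℝ)).smul_const e).const_add q
  have hclosed : IsClosed (Set.range fun u : ℝ => q + u • e) := by
    have : Isometry fun u : ℝ => q + u • e := Isometry.of_dist_eq fun s t => by
      simp [dist_eq_norm, ← sub_smul, norm_smul, he]
    exact this.isClosedEmbedding.isClosed_range
  obtain ⟨σ, hσ, -, h⟩ := exists_isTame_lintegral_le (by fun_prop) hd he hclosed.measurableSet μ
    (by simpa using hfin) (b := b) (by simpa using hb)
  exact ⟨σ, hσ, h⟩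

/-- The pointwise Euler–Lagrange inequality. -/
lemma IsMinimizer.wEnergy_le_wPot {γ : ℝ → Plane} {Γ : Set Plane} (hΓ : RegularCurve γ Γ)
    {a : ℝ} (ha : a ∈ Set.Ioo (0 : ℝ) 1) {μ : Measure Plane} (hmin : IsMinimizer Γ a μ)
    {p : Plane} (hp : p ∈ Γ) (q : Plane) :
    wEnergy μ ≤ ENNReal.ofReal a * wPot μ p + ENNReal.ofReal (1 - a) * wPot μ q := by
  have ha1 : 0 < 1 - a := sub_pos.2 ha.2
  have hprob : IsProbabilityMeasure μ := hmin.1.1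
  by_cases hpt : wPot μ p = ⊤
  · rw [hpt, ENNReal.mul_top (by simpa using ha.1), top_add]; exact le_top
  by_cases hqt : wPot μ q = ⊤
  · rw [hqt, ENNReal.mul_top (by simpa using ha.2), add_top]; exact le_top
  refine ENNReal.le_of_forall_pos_le_add fun η hη _ => ?_
  have hη' : (η : ℝ≥0∞) ≠ 0 := by simpa using hη.ne'
  obtain ⟨s₀, rfl⟩ : p ∈ Set.range γ := hΓ.image ▸ hp
  obtain ⟨σ, hσ, hσΓ, h1⟩ := exists_isTame_lintegral_le hΓ.contDiff.continuous
    (hΓ.contDiff.hasStrictDerivAt one_ne_zero) (hΓ.unitSpeed s₀)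
    (hΓ.image ▸ hΓ.closed.measurableSet) μ hpt (ENNReal.lt_add_right hpt hη')
  obtain ⟨τ, hτ, h2⟩ := exists_isTame_lintegral_le_of_point q μ hqt (ENNReal.lt_add_right hqt hη')
  have hcombo := hσ.combo hτ ha.1.le ha.2.le
  have hmem : ENNReal.ofReal a • σ + ENNReal.ofReal (1 - a) • τ ∈ Ma Γ a := by
    refine ⟨hcombo.prob, ?_⟩
    rw [← hΓ.image] at hσΓ
    simp [hσΓ]
  refine (hmin.wEnergy_le_lintegral hmem hcombo.wEnergy_ne_top).trans ?_
  rw [lintegral_add_measure, lintegral_smul_measure, lintegral_smul_measure]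
  simp only [smul_eq_mul]
  calc ENNReal.ofReal a * ∫⁻ z, wPot μ z ∂σ + ENNReal.ofReal (1 - a) * ∫⁻ z, wPot μ z ∂τ
      ≤ ENNReal.ofReal a * (wPot μ (γ s₀) + η) + ENNReal.ofReal (1 - a) * (wPot μ q + η) := by
        gcongr
    _ = ENNReal.ofReal a * wPot μ (γ s₀) + ENNReal.ofReal (1 - a) * wPot μ q +
          (ENNReal.ofReal a + ENNReal.ofReal (1 - a)) * η := by ring
    _ = _ := by rw [← ENNReal.ofReal_add ha.1.le ha1.le]; simp

/-- Interpolation between the infimum of a function over `Γ` and its global infimum. -/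
lemma convex_combination_le_of_le_measure {Γ : Set Plane} {a : ℝ} (h0 : 0 ≤ a) (h1 : a ≤ 1)
    {ν : Measure Plane} (hΓ : MeasurableSet Γ) (hν : ν ∈ Ma Γ a) {c d : ℝ≥0∞} (hdc : d ≤ c) :
    ENNReal.ofReal a * c + ENNReal.ofReal (1 - a) * d ≤ c * ν Γ + d * ν Γᶜ := by
  obtain ⟨hp, hle⟩ := hν
  obtain ⟨k, hk⟩ := exists_add_of_le hle
  have hcompl : ENNReal.ofReal (1 - a) = k + ν Γᶜ := by
    have h2 : ENNReal.ofReal a + (k + ν Γᶜ) = 1 := by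
      rw [← add_assoc, ← hk, measure_add_measure_compl hΓ, measure_univ]
    have h3 : ENNReal.ofReal a + ENNReal.ofReal (1 - a) = 1 := by
      rw [← ENNReal.ofReal_add h0 (sub_nonneg.2 h1)]; simp
    exact (ENNReal.add_right_inj ENNReal.ofReal_ne_top).1 (h3.trans h2.symm)
  rw [hcompl, hk]
  calc ENNReal.ofReal a * c + (k + ν Γᶜ) * d = ENNReal.ofReal a * c + k * d + ν Γᶜ * d := by ring
    _ ≤ ENNReal.ofReal a * c + k * c + ν Γᶜ * d := by gcongr
    _ = _ := by ring

/-- if `μ_a` minimizes `I` over `M_a` and `ν ∈ M_a` is compactly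
supported with finite logarithmic energy, then `∫ (2U^{μ_a} + |x|²) d(ν - μ_a) ≥ 0`. -/
theorem statement5 (γ : ℝ → Plane) (Γ : Set Plane) (hΓ : RegularCurve γ Γ)
    (a : ℝ) (ha : a ∈ Set.Ioo (0:ℝ) 1)
    (μa : Measure Plane) (hmin : IsMinimizer Γ a μa)
    (ν : Measure Plane) (hν : ν ∈ Ma Γ a)
    (Kν : Set Plane) (hKν : IsCompact Kν) (hνK : ν Kνᶜ = 0)
    (hEν : Integrable (fun p : Plane × Plane => logKernel p.1 p.2) (ν.prod ν)) :
    0 ≤ (∫ x, (2 * logPot μa x + ‖x‖ ^ 2) ∂ν) - ∫ x, (2 * logPot μa x + ‖x‖ ^ 2) ∂μa := by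
  have hpμ : IsProbabilityMeasure μa := hmin.1.1
  have hpν : IsProbabilityMeasure ν := hν.1
  have hΓm : MeasurableSet Γ := hΓ.closed.measurableSet
  have hVm := measurable_wPot μa
  have hJ : wEnergy μa = ∫⁻ x, wPot μa x ∂μa := wEnergy_eq μa
  have hJtop : ∫⁻ x, wPot μa x ∂μa ≠ ⊤ := hJ ▸ hmin.2.1.ne
  have hatom : ∀ x, μa {x} = 0 := by
    intro x
    by_contra h0
    refine h0 (measure_singleton_of_wPot_ne_top fun hx => hJtop (top_le_iff.1 ?_))
    calc ⊤ = ∫⁻ y in {x}, wPot μa y ∂μa := by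
          rw [lintegral_singleton, hx, ENNReal.top_mul h0]
      _ ≤ _ := setLIntegral_le_lintegral _ _
  set c : ℝ≥0∞ := ⨅ p : Γ, wPot μa p with hc
  set d : ℝ≥0∞ := ⨅ q, wPot μa q with hd
  have hdc : d ≤ c := le_iInf fun p => iInf_le _ _
  have hpos : μa Γ ≠ 0 := fun h => by
    have := hmin.1.2
    rw [h] at this
    simp [ha.1.not_ge] at this
  have hc_top : c ≠ ⊤ := by
    have hfin : ∀ᵐ x ∂μa, wPot μa x < ⊤ := ae_lt_top hVm hJtop
    obtain ⟨p, hpΓ, hp⟩ := ((frequently_ae_mem_iff.2 hpos).and_eventually hfin).exists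
    exact ne_top_of_le_ne_top hp.ne (iInf_le (fun p : Γ => wPot μa p) ⟨p, hpΓ⟩)
  have hEL : wEnergy μa ≤ ENNReal.ofReal a * c + ENNReal.ofReal (1 - a) * d := by
    obtain ⟨p₀, hp₀⟩ := nonempty_of_measure_ne_zero hpos
    have : Nonempty Γ := ⟨⟨p₀, hp₀⟩⟩
    rw [hc, hd, ENNReal.mul_iInf_of_ne (by simpa using ha.1) ENNReal.ofReal_ne_top,
      ENNReal.mul_iInf_of_ne (by simpa using ha.2) ENNReal.ofReal_ne_top]
    simp_rw [ENNReal.iInf_add, ENNReal.add_iInf]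
    exact le_iInf fun p => le_iInf fun q => hmin.wEnergy_le_wPot hΓ ha p.2 q
  set f : Plane → ℝ≥0∞ := fun x => Γ.indicator (fun _ => c) x + Γᶜ.indicator (fun _ => d) x with hf
  have hfV : ∀ x, f x ≤ wPot μa x := by
    intro x
    by_cases hx : x ∈ Γ
    · simpa [hf, hx] using iInf_le (fun p : Γ => wPot μa p) ⟨x, hx⟩
    · simpa [hf, hx] using iInf_le (wPot μa) x
  have hfc : ∀ x, f x ≤ c := by
    intro x
    by_cases hx : x ∈ Γ
    · simp [hf, hx]
    · simpa [hf, hx] using hdc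
  have hJf : ∀ ρ ∈ Ma Γ a, wEnergy μa ≤ ∫⁻ x, f x ∂ρ := by
    intro ρ hρ
    refine (hEL.trans (convex_combination_le_of_le_measure ha.1.le ha.2.le hΓm hρ hdc)).trans_eq ?_
    rw [hf, lintegral_add_left (measurable_const.indicator hΓm),
      lintegral_indicator_const hΓm, lintegral_indicator_const hΓm.compl]
  have hae : f =ᵐ[μa] wPot μa :=
    ae_eq_of_ae_le_of_lintegral_le (Filter.Eventually.of_forall hfV)
      (ne_top_of_le_ne_top hJtop (lintegral_mono hfV)) hVm.aemeasurable (hJ ▸ hJf μa hmin.1)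
  have hVle := wPot_le_of_ae_le hc_top hatom (hae.mono fun x hx => hx ▸ hfc x)
  have hVfin : ∀ x, wPot μa x ≠ ⊤ := fun x => ne_top_of_le_ne_top (by finiteness) (hVle x)
  have hνtop : ∫⁻ x, wPot μa x ∂ν ≠ ⊤ := by
    obtain ⟨R, hR⟩ := hKν.isBounded.exists_norm_le
    refine ne_top_of_le_ne_top (b := c + ENNReal.ofReal (Real.log 3 + R ^ 2 / 2)) (by finiteness) ?_
    calc ∫⁻ x, wPot μa x ∂ν ≤ ∫⁻ _, (c + ENNReal.ofReal (Real.log 3 + R ^ 2 / 2)) ∂ν := by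
          refine lintegral_mono_ae ?_
          filter_upwards [compl_mem_ae_iff.2 hνK] with x hx
          have hxR : ‖x‖ ≤ R := hR x (by simpa using hx)
          refine (hVle x).trans ?_
          gcongr
      _ = _ := by simp
  have hcomp : ∫⁻ x, wPot μa x ∂μa ≤ ∫⁻ x, wPot μa x ∂ν :=
    hJ ▸ (hJf ν hν).trans (lintegral_mono hfV)
  have hint : ∀ ρ : Measure Plane, IsProbabilityMeasure ρ → ∫⁻ x, wPot μa x ∂ρ ≠ ⊤ →
      ∫ x, (2 * logPot μa x + ‖x‖ ^ 2) ∂ρ =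
        2 * (∫⁻ x, wPot μa x ∂ρ).toReal - ((∫ y : Plane, ‖y‖ ^ 2 ∂μa) + 2) := by
    intro ρ _ hρ
    simp_rw [fun x => (integrable_and_logPot_eq (hVfin x)).2]
    rw [integral_sub ((integrable_toReal_of_lintegral_ne_top hVm.aemeasurable hρ).const_mul 2)
      (integrable_const _), integral_const_mul, integral_toReal hVm.aemeasurable
      (Filter.Eventually.of_forall fun x => (hVfin x).lt_top)]
    simp
  rw [hint ν hpν hνtop, hint μa hpμ hJtop]
  have := ENNReal.toReal_mono hνtop hcomp
  linarith
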